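/- Let p be a prime, K a field of characteristic p, β ∈ K with β^p = β + 1, and y ∈ K. Set x := y^p − y and assume x ≠ 0 and x ≠ 1. Then for every natural number n there exists u ∈ Kˣ such that δ(y + n) = δ(y)·(x/(1−x))^n·u^p. (This is the well-definedness of the ℋ_AS-torsor action in §5: if z^p ≡ δ(y) and w^p ≡ x/(1−x) modulo p-th powers, then (ζ·z·w^a)^p ≡ δ(y+a) modulo p-th powers.) -/

import Mathlib

open Finset Polynomial in
theorem prod_range_sub_natCast_eq_pow_sub {K : Type*} [Field K] (p : ℕ) (hp : p.Prime) [CharP K p]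
    (z : K) : ∏ a ∈ range p, (z - (a : K)) = z ^ p - z := by
  have := Fact.mk hp
  have h : ∏ a ∈ range p, (X - C (a : K)) = X ^ p - X := by
    have hm : (∏ a ∈ range p, (X - C (a : K))).Monic := monic_prod_X_sub_C _ _
    have hd : (∏ a ∈ range p, (X - C (a : K))).degree = (p : WithBot ℕ) := by
      simp [degree_prod, -map_natCast]
    have hm' : (X ^ p - X : K[X]).Monic := monic_X_pow_sub (by simpa using hp.one_lt)
    have hd' : (X ^ p - X : K[X]).degree = p := by
      rw [degree_eq_natDegree hm'.ne_zero, FiniteField.X_pow_card_sub_X_natDegree_eq K hp.one_lt]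
    refine eq_of_degree_sub_lt_of_eval_index_eq (range p) (v := fun a : ℕ => (a : K)) ?_ ?_ ?_
    · simpa using CharP.natCast_injOn_Iio K p
    · rw [card_range, ← hd]
      exact degree_sub_lt_left (hd.trans hd'.symm) hm.ne_zero
        (hm.leadingCoeff.trans hm'.leadingCoeff.symm)
    · intro a ha
      have hFr : (a : K) ^ p = a := map_natCast (frobenius K p) a
      rw [eval_prod, prod_eq_zero ha (by simp)]
      simp [hFr]
  simpa [eval_prod] using congrArg (eval z) h

open Finset in
theorem prod_range_add_natCast_eq_pow_sub {K : Type*} [Field K] (p : ℕ) (hp : p.Prime) [CharP K p]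
    (z : K) : ∏ a ∈ range p, (z + (a : K)) = z ^ p - z := by
  have := Fact.mk hp
  have hneg : (-1 : K) ^ p = -1 := neg_one_pow_char K p
  have h := prod_range_sub_natCast_eq_pow_sub p hp (-z)
  have h' : ∏ a ∈ range p, (-z - (a : K)) = -∏ a ∈ range p, (z + (a : K)) := by
    simp_rw [← neg_add', prod_neg, card_range, hneg, neg_one_mul]
  rw [h', neg_pow, hneg] at h
  linear_combination -h

open Finset in
theorem prod_range_shift_pow_mul_prod {M : Type*} [CommMonoid M] (g : ℕ → M) (m : ℕ) :
    (∏ a ∈ range m, g (a + 1) ^ a) * ∏ a ∈ range m, g (a + 1) =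
      (∏ a ∈ range m, g a ^ a) * g m ^ m := by
  rw [← prod_range_succ (fun a => g a ^ a), prod_range_succ', ← prod_mul_distrib]
  simp [pow_succ]

open Finset in
theorem prod_Icc_one_pow_eq_prod_range {M : Type*} [CommMonoid M] (g : ℕ → M) {m : ℕ}
    (hm : 0 < m) : ∏ a ∈ Icc 1 (m - 1), g a ^ a = ∏ a ∈ range m, g a ^ a := by
  have hIcc : Icc 1 (m - 1) = Ico 1 m := by ext; simp; lia
  rw [prod_range_eq_mul_Ico _ hm, hIcc]
  simp

open Finset in
/-- The case of a shift by one, where the `p`-th power can be taken to be that of `(β - y) / y`. -/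
theorem prod_shift_one_eq_mul_pow {K : Type*} [Field K] (p : ℕ) (hp : p.Prime) [CharP K p]
    (β y : K) (hβ : β ^ p = β + 1) (hx0 : y ^ p - y ≠ 0) (hx1 : y ^ p - y ≠ 1) :
    ∃ u : Kˣ,
      (∏ a ∈ Icc 1 (p - 1), ((β - (y + 1) - (a : K)) / ((y + 1) + (a : K))) ^ a)
        = (∏ a ∈ Icc 1 (p - 1), ((β - y - (a : K)) / (y + (a : K))) ^ a)
          * ((y ^ p - y) / (1 - (y ^ p - y))) * (u : K) ^ p := by
  have := Fact.mk hp
  set g : ℕ → K := fun a => (β - y - (a : K)) / (y + (a : K)) with hg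
  have hx1' : 1 - (y ^ p - y) ≠ 0 := sub_ne_zero.2 hx1.symm
  have hgp : g p = g 0 := by simp [hg]
  have hprod : ∏ a ∈ range p, g a = (1 - (y ^ p - y)) / (y ^ p - y) := by
    rw [prod_div_distrib, prod_range_sub_natCast_eq_pow_sub p hp,
      prod_range_add_natCast_eq_pow_sub p hp, sub_pow_char, hβ]
    ring
  have hg0 : g 0 ≠ 0 := by
    have hne : ∏ a ∈ range p, g a ≠ 0 := hprod ▸ div_ne_zero hx1' hx0
    exact prod_ne_zero_iff.1 hne 0 (mem_range.2 hp.pos)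
  have hshift : ∏ a ∈ range p, g (a + 1) = ∏ a ∈ range p, g a :=
    mul_right_cancel₀ hg0 (by rw [← prod_range_succ', prod_range_succ, hgp])
  have hcast (a : ℕ) : (β - (y + 1) - (a : K)) / ((y + 1) + (a : K)) = g (a + 1) := by
    simp only [hg, Nat.cast_add, Nat.cast_one]
    congr 1 <;> ring
  refine ⟨Units.mk0 (g 0) hg0, ?_⟩
  have h := prod_range_shift_pow_mul_prod g p
  rw [hshift, hprod, hgp] at h
  simp_rw [hcast]
  rw [prod_Icc_one_pow_eq_prod_range (fun a => g (a + 1)) hp.pos,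
    prod_Icc_one_pow_eq_prod_range g hp.pos, Units.val_mk0, mul_right_comm, ← h]
  field_simp


/-- Well-definedness of the `ℋ_AS`-torsor action of §5: with `x = y^p − y ≠ 0, 1` and
`δ(u) = ∏_{a=1}^{p−1}((β−u−a)/(u+a))^a`, for each `n` there is `u ∈ Kˣ` with
`δ(y+n) = δ(y)·(x/(1−x))^n·u^p`. -/
theorem stmt_13 {K : Type*} [Field K] (p : ℕ) (hp : p.Prime) [CharP K p]
    (β y : K) (hβ : β ^ p = β + 1)
    (hx0 : y ^ p - y ≠ 0) (hx1 : y ^ p - y ≠ 1) (n : ℕ) :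
    ∃ u : Kˣ,
      (∏ a ∈ Finset.Icc 1 (p - 1), ((β - (y + (n : K)) - (a : K)) / ((y + (n : K)) + (a : K))) ^ a)
        = (∏ a ∈ Finset.Icc 1 (p - 1), ((β - y - (a : K)) / (y + (a : K))) ^ a)
          * ((y ^ p - y) / (1 - (y ^ p - y))) ^ n * (u : K) ^ p := by
  have := Fact.mk hp
  induction n with
  | zero => exact ⟨1, by simp⟩
  | succ n ih =>
    obtain ⟨u, hu⟩ := ih
    have hFr : (n : K) ^ p = n := map_natCast (frobenius K p) n
    have hx : (y + n) ^ p - (y + n) = y ^ p - y := by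
      rw [add_pow_char, hFr]
      ring
    obtain ⟨v, hv⟩ := prod_shift_one_eq_mul_pow p hp β (y + n) hβ (hx ▸ hx0) (hx ▸ hx1)
    refine ⟨u * v, ?_⟩
    rw [Nat.cast_succ, ← add_assoc, hv, hu, hx, Units.val_mul]
    ring
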